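/- arXiv:1111.0478 — 3 statements merged into one kernel-verified Lean document; each statement's English description precedes it below -/
import Mathlib

section
/- Let N ≥ 1, let p₁, …, p_N be real numbers with pₙ > 0 for all n and Σₙ pₙ = 1, and let q₁, …, q_N be complex polynomials. For each n define ψₙ : ℝ → ℂ by ψₙ(x) = qₙ(x)·exp(−x²/2), and assume ∫_ℝ |ψₙ(x)|² dx = 1 for every n. Define the Wigner function W : ℝ × ℝ → ℂ by W(x, u) = (1/π) Σₙ pₙ ∫_ℝ conj(ψₙ(x + y)) ψₙ(x − y) exp(2 i u y) dy. If there exist a complex constant C and real numbers a, b, c, d, e, f such that W(x, u) = C·exp(a x² + b u² + c x u + d x + e u + f) for all real x, u, then every polynomial qₙ is constant (has degree ≤ 0). (This is the paper's Lemma 1: any finite-dimensional quantum state of dimension d ≥ 2 is non-Gaussian; a finite mixture of states whose wavefunctions are polynomials times the Gaussian ground-state factor has a Gaussian Wigner function only if it is the vacuum projector.) -/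
open MeasureTheory Polynomial ComplexConjugate Real

/-- A complex polynomial agreeing on the real line with a multiple of the exponential of a
quadratic polynomial is constant. -/
theorem eval_ofReal_eq_of_eq_exp_quadratic (R : ℂ[X]) (K α β : ℂ)
    (h : ∀ x : ℝ, R.eval (x : ℂ) = K * Complex.exp (α * x ^ 2 + β * x)) (z w : ℂ) :
    R.eval z = R.eval w := by
  have hfactor : derivative R = (C (2 * α) * X + C β) * R := by
    apply eq_of_infinite_eval_eq
    refine (Set.infinite_range_of_injective Complex.ofReal_injective).mono ?_
    rintro _ ⟨x, rfl⟩
    have hR := (R.hasDerivAt (x : ℂ)).comp_ofReal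
    have hexp : HasDerivAt (fun z : ℂ => K * Complex.exp (α * z ^ 2 + β * z))
        (K * (Complex.exp (α * (x : ℂ) ^ 2 + β * x) * (α * (2 * x) + β))) (x : ℂ) := by
      have hquad : HasDerivAt (fun z : ℂ => α * z ^ 2 + β * z) (α * (2 * x) + β) (x : ℂ) := by
        refine (((hasDerivAt_pow 2 (x : ℂ)).const_mul α).fun_add
          ((hasDerivAt_id' (x : ℂ)).const_mul β)).congr_deriv ?_
        simp
      exact hquad.cexp.const_mul K
    have hderiv := hR.unique (by simpa only [h] using hexp.comp_ofReal)
    simp only [Set.mem_ofPred_eq, eval_mul, eval_add, eval_C, eval_X, hderiv, h]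
    ring
  have hzero : derivative R = 0 := by
    by_contra hne
    have hR : R ≠ 0 := by
      rintro rfl
      simp at hne
    have hlin : C (2 * α) * X + C β ≠ 0 := by
      intro h0
      rw [h0, zero_mul] at hfactor
      exact hne hfactor
    have hlt := degree_derivative_lt hR
    rw [hfactor, mul_comm] at hlt
    exact absurd (degree_le_mul_left R hlin) (not_le.mpr hlt)
  rw [eq_C_of_derivative_eq_zero hzero]
  simp

/-- The restriction to the real line of a polynomial times the Gaussian `exp (-y ^ 2)` is
integrable. -/
theorem integrable_eval_ofReal_mul_gaussian (r : ℂ[X]) :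
    Integrable fun y : ℝ => r.eval (y : ℂ) * Complex.exp (-(y : ℂ) ^ 2) := by
  induction r using Polynomial.induction_on' with
  | add r s hr hs =>
    simp only [eval_add, add_mul]
    exact hr.add hs
  | monomial n a =>
    have hn : (-1 : ℝ) < n := by
      have : (0 : ℝ) ≤ n := n.cast_nonneg
      linarith
    have hint := ((integrable_rpow_mul_exp_neg_mul_sq one_pos hn).ofReal (𝕜 := ℂ)).const_mul a
    refine hint.congr (.of_forall fun y => ?_)
    simp [mul_assoc]

theorem integrable_eval_ofReal_mul_gaussian_mul_exp (u : ℝ) (r : ℂ[X]) :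
    Integrable fun y : ℝ => r.eval (y : ℂ) * Complex.exp (-(y : ℂ) ^ 2) *
      Complex.exp (2 * Complex.I * u * y) := by
  refine (integrable_eval_ofReal_mul_gaussian r).mul_bdd (c := 1)
    (by fun_prop) (.of_forall fun y => ?_)
  simp [Complex.norm_exp]

/-- The Fourier transform of `r(y) * exp (-y ^ 2)` at `u`, as a linear functional of the
polynomial `r`. -/
noncomputable def gaussianFourier (u : ℝ) : ℂ[X] →ₗ[ℂ] ℂ where
  toFun r := ∫ y : ℝ, r.eval (y : ℂ) * Complex.exp (-(y : ℂ) ^ 2) *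
    Complex.exp (2 * Complex.I * u * y)
  map_add' r s := by
    simp only [eval_add, add_mul]
    exact integral_add (integrable_eval_ofReal_mul_gaussian_mul_exp u r)
      (integrable_eval_ofReal_mul_gaussian_mul_exp u s)
  map_smul' a r := by
    simp only [eval_smul, smul_eq_mul, mul_assoc, RingHom.id_apply]
    exact integral_const_mul _ _

theorem gaussianFourier_apply (u : ℝ) (r : ℂ[X]) :
    gaussianFourier u r = ∫ y : ℝ, r.eval (y : ℂ) * Complex.exp (-(y : ℂ) ^ 2) *
      Complex.exp (2 * Complex.I * u * y) := rfl

open FourierTransform in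
theorem eq_zero_of_gaussianFourier_eq_zero {r : ℂ[X]} (h : ∀ u, gaussianFourier u r = 0) :
    r = 0 := by
  set g : ℝ → ℂ := fun y => r.eval (y : ℂ) * Complex.exp (-(y : ℂ) ^ 2) with hg
  have hF : 𝓕 g = 0 := by
    ext w
    rw [Real.fourier_real_eq_integral_exp_smul, Pi.zero_apply, ← h (-(π * w)),
      gaussianFourier_apply]
    refine integral_congr_ae (.of_forall fun y => ?_)
    simp only [smul_eq_mul, hg]
    rw [mul_comm]
    congr 2
    push_cast
    ring
  have hcont : Continuous g := by fun_prop
  have hinv := hcont.fourierInv_fourier_eq (integrable_eval_ofReal_mul_gaussian r)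
    (by rw [hF]; exact integrable_zero _ _ _)
  have hg0 : g = 0 := by
    rw [← hinv, hF]
    ext y
    simp [Real.fourierInv_eq]
  apply eq_zero_of_infinite_isRoot
  refine (Set.infinite_range_of_injective Complex.ofReal_injective).mono ?_
  rintro _ ⟨y, rfl⟩
  simpa [hg, Complex.exp_ne_zero] using congrFun hg0 y

/-- Applying a linear functional to the inner variable of a bivariate polynomial yields a
polynomial in the outer variable. -/
theorem exists_eval_eq_linearMap_eval_C (L : ℂ[X] →ₗ[ℂ] ℂ) (T : ℂ[X][X]) :
    ∃ R : ℂ[X], ∀ x : ℂ, L (T.eval (C x)) = R.eval x := by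
  induction T using Polynomial.induction_on' with
  | add S T hS hT =>
    obtain ⟨A, hA⟩ := hS
    obtain ⟨B, hB⟩ := hT
    exact ⟨A + B, fun x => by simp [hA, hB]⟩
  | monomial k a =>
    refine ⟨monomial k (L a), fun x => ?_⟩
    rw [eval_monomial, eval_monomial, ← C_pow, mul_comm, ← smul_eq_C_mul, map_smul, smul_eq_mul,
      mul_comm]

/-- The correlation polynomial of a mixture: with `x` fixed, it is the polynomial in `y` given by
`∑ n, p n * conj (q n) (x + y) * q n (x - y)`. -/
noncomputable def correlationPoly {N : ℕ} (p : Fin N → ℝ) (q : Fin N → ℂ[X]) (x : ℂ) : ℂ[X] :=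
  ∑ n, (p n : ℂ) • (((q n).map (starRingEnd ℂ)).comp (C x + X) * (q n).comp (C x - X))

theorem exists_eval_C_eq_correlationPoly {N : ℕ} (p : Fin N → ℝ) (q : Fin N → ℂ[X]) :
    ∃ T : ℂ[X][X], ∀ x : ℂ, T.eval (C x) = correlationPoly p q x := by
  refine ⟨∑ n, C (C (p n : ℂ)) * ((((q n).map (starRingEnd ℂ)).map C).comp (X + C X) *
    ((q n).map C).comp (X - C X)), fun x => ?_⟩
  simp only [correlationPoly, eval_finsetSum, eval_mul, eval_comp, eval_add, eval_sub, eval_C,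
    eval_X, smul_eq_C_mul, eval_map C]
  rfl

theorem conj_eval_ofReal (r : ℂ[X]) (x : ℝ) :
    conj (r.eval (x : ℂ)) = (r.map (starRingEnd ℂ)).eval (x : ℂ) := by
  rw [eval_map, ← eval₂_at_apply, Complex.conj_ofReal]

/-- The Wigner integral of a mixture of polynomial-times-Gaussian wavefunctions, in terms of the
correlation polynomial. -/
theorem sum_wigner_integral_eq {N : ℕ} (p : Fin N → ℝ) (q : Fin N → ℂ[X]) (ψ : Fin N → ℝ → ℂ)
    (hψ : ∀ n x, ψ n x = (q n).eval (x : ℂ) * Complex.exp (-(x : ℂ) ^ 2 / 2)) (x u : ℝ) :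
    ∑ n, (p n : ℂ) *
        ∫ y : ℝ, conj (ψ n (x + y)) * ψ n (x - y) * Complex.exp (2 * Complex.I * u * y) =
      Complex.exp (-(x : ℂ) ^ 2) * gaussianFourier u (correlationPoly p q x) := by
  rw [correlationPoly, map_sum, Finset.mul_sum]
  refine Finset.sum_congr rfl fun n _ => ?_
  rw [map_smul, smul_eq_mul, mul_left_comm]
  congr 1
  rw [gaussianFourier_apply, ← integral_const_mul]
  refine integral_congr_ae (.of_forall fun y => ?_)
  dsimp only
  have hexp : conj (Complex.exp (-((x + y : ℝ) : ℂ) ^ 2 / 2)) *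
      Complex.exp (-((x - y : ℝ) : ℂ) ^ 2 / 2) =
      Complex.exp (-(x : ℂ) ^ 2) * Complex.exp (-(y : ℂ) ^ 2) := by
    rw [← Complex.exp_conj, ← Complex.exp_add, ← Complex.exp_add]
    congr 1
    simp only [map_div₀, map_neg, map_pow, map_ofNat, map_add, Complex.conj_ofReal,
      Complex.ofReal_add, Complex.ofReal_sub]
    ring
  rw [hψ, hψ, map_mul, conj_eval_ofReal, mul_mul_mul_comm, hexp]
  simp only [eval_mul, eval_comp, eval_add, eval_sub, eval_C, eval_X, Complex.ofReal_add,
    Complex.ofReal_sub]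
  ring

theorem eval_zero_correlationPoly {N : ℕ} (p : Fin N → ℝ) (q : Fin N → ℂ[X]) (x : ℝ) :
    (correlationPoly p q x).eval 0 = ((∑ n, p n * ‖(q n).eval (x : ℂ)‖ ^ 2 : ℝ) : ℂ) := by
  simp [correlationPoly, eval_finsetSum, eval_comp, ← conj_eval_ofReal, Complex.conj_mul']

/-- A complex polynomial whose norm is bounded on the real line is constant. -/
theorem degree_le_zero_of_norm_sq_le (r : ℂ[X]) (K : ℝ)
    (h : ∀ x : ℝ, ‖r.eval (x : ℂ)‖ ^ 2 ≤ K) : r.degree ≤ 0 := by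
  by_contra! hpos
  have hz : Filter.Tendsto (fun x : ℝ => ‖(x : ℂ)‖) Filter.atTop Filter.atTop := by
    simpa using Filter.tendsto_abs_atTop_atTop
  have hlim := (Filter.tendsto_pow_atTop two_ne_zero).comp (r.tendsto_norm_atTop hpos hz)
  obtain ⟨x, hx⟩ := (hlim.eventually_gt_atTop K).exists
  exact absurd (h x) (not_le.mpr hx)

/-- **Lemma 1 (non-Gaussianity of finite-dimensional states).** Consider a finite mixture
(with positive weights `pₙ` summing to 1) of pure states whose position wavefunctions are
`ψₙ(x) = qₙ(x)·exp(−x²/2)` with `qₙ` complex polynomials (i.e. states supported on a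
finite-dimensional subspace of Fock space), each normalized. If the Wigner function
`W(x,u) = (1/π) Σₙ pₙ ∫ conj(ψₙ(x+y)) ψₙ(x−y) e^{2iuy} dy` is Gaussian, i.e. of the form
`C·exp(ax² + bu² + cxu + dx + eu + f)` with real coefficients, then every `qₙ` is
constant, so the state is the vacuum projector. -/
theorem finite_dim_state_nonGaussian
    (N : ℕ) (hN : 1 ≤ N)
    (p : Fin N → ℝ) (hp : ∀ n, 0 < p n) (hpsum : ∑ n, p n = 1)
    (q : Fin N → Polynomial ℂ)
    (ψ : Fin N → ℝ → ℂ)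
    (hψ : ∀ n x, ψ n x = (q n).eval (x : ℂ) * Complex.exp (-(x : ℂ) ^ 2 / 2))
    (hnorm : ∀ n, ∫ x : ℝ, ‖ψ n x‖ ^ 2 = 1)
    (W : ℝ → ℝ → ℂ)
    (hW : ∀ x u : ℝ, W x u =
      (1 / (Real.pi : ℂ)) * ∑ n, (p n : ℂ) *
        ∫ y : ℝ, conj (ψ n (x + y)) * ψ n (x - y) * Complex.exp (2 * Complex.I * u * y))
    (hGauss : ∃ (C : ℂ) (a b c d e f : ℝ), ∀ x u : ℝ,
      W x u = C * Complex.exp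
        ((a * x ^ 2 + b * u ^ 2 + c * x * u + d * x + e * u + f : ℝ) : ℂ)) :
    ∀ n, (q n).degree ≤ 0 := by
  obtain ⟨K, a, b, c, d, e, f, hG⟩ := hGauss
  obtain ⟨T, hT⟩ := exists_eval_C_eq_correlationPoly p q
  have hfourier (u x : ℝ) : gaussianFourier u (correlationPoly p q x) =
      (π * K * Complex.exp (b * u ^ 2 + e * u + f)) *
        Complex.exp ((a + 1) * x ^ 2 + (c * u + d) * x) := by
    have hWxu := hW x u
    rw [hG, sum_wigner_integral_eq p q ψ hψ] at hWxu
    have hπ : (π : ℂ) ≠ 0 := by exact_mod_cast Real.pi_ne_zero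
    have hexp : Complex.exp ((x : ℂ) ^ 2) * Complex.exp (-(x : ℂ) ^ 2) = 1 := by
      rw [← Complex.exp_add]
      simp
    calc gaussianFourier u (correlationPoly p q x)
        = π * Complex.exp ((x : ℂ) ^ 2) * (1 / π * (Complex.exp (-(x : ℂ) ^ 2) *
            gaussianFourier u (correlationPoly p q x))) := by
          field_simp
          rw [mul_assoc, hexp, mul_one]
      _ = π * K * (Complex.exp ((x : ℂ) ^ 2) * Complex.exp
            ((a * x ^ 2 + b * u ^ 2 + c * x * u + d * x + e * u + f : ℝ) : ℂ)) := by
          rw [← hWxu]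
          ring
      _ = _ := by
          rw [mul_assoc (π * K : ℂ), ← Complex.exp_add, ← Complex.exp_add]
          congr 2
          push_cast
          ring
  have hconst (x : ℝ) : correlationPoly p q x = correlationPoly p q 0 := by
    rw [← sub_eq_zero]
    refine eq_zero_of_gaussianFourier_eq_zero fun u => ?_
    obtain ⟨R, hR⟩ := exists_eval_eq_linearMap_eval_C (gaussianFourier u) T
    simp only [hT] at hR
    rw [map_sub, sub_eq_zero, hR, hR]
    exact eval_ofReal_eq_of_eq_exp_quadratic R _ _ _
      (fun t => (hR t).symm.trans (hfourier u t)) _ _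
  intro n
  refine degree_le_zero_of_norm_sq_le (q n)
    ((∑ m, p m * ‖(q m).eval ((0 : ℝ) : ℂ)‖ ^ 2) / p n) fun x => ?_
  have hsum : ∑ m, p m * ‖(q m).eval (x : ℂ)‖ ^ 2 =
      ∑ m, p m * ‖(q m).eval ((0 : ℝ) : ℂ)‖ ^ 2 := by
    apply Complex.ofReal_injective
    rw [← eval_zero_correlationPoly, ← eval_zero_correlationPoly, hconst, Complex.ofReal_zero]
  rw [le_div_iff₀' (hp n), ← hsum]
  exact Finset.single_le_sum (f := fun m => p m * ‖(q m).eval (x : ℂ)‖ ^ 2)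
    (fun m _ => mul_nonneg (hp m).le (sq_nonneg _)) (Finset.mem_univ n)
end

section
/- Let ι be any index type and let α : ι → ℂ be injective. Then the family of coherent states (c_{α(i)})_{i ∈ ι} is linearly independent in ℓ²(ℕ, ℂ). In particular, any finite collection of coherent states with pairwise distinct amplitudes (such as the vacuum c_0 and c_{±α} for α ≠ 0) is linearly independent. -/
/-- If a linear combination of geometric sequences with pairwise distinct ratios in an integral
domain vanishes identically, then all its coefficients are zero. -/
theorem eq_zero_of_forall_sum_mul_pow_eq_zero {R ι : Type*} [CommRing R] [IsDomain R]
    {a : ι → R} (ha : Function.Injective a) {s : Finset ι} {g : ι → R}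
    (hg : ∀ n : ℕ, ∑ i ∈ s, g i * a i ^ n = 0) {i : ι} (hi : i ∈ s) : g i = 0 := by
  have h := (linearIndependent_monoidHom (Multiplicative ℕ) R).comp (fun i => powersHom R (a i))
    ((powersHom R).injective.comp ha)
  refine linearIndependent_iff'.mp h s g ?_ i hi
  funext n
  simpa using hg n.toAdd

/-- Coherent states with pairwise distinct amplitudes are linearly independent in
`ℓ²(ℕ, ℂ)`: if `α : ι → ℂ` is injective then the family `(c_{α i})` is linearly
independent, where `c_β(n) = exp(−|β|²/2)·βⁿ/√(n!)`. -/
theorem coherent_states_linearIndependent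
    (c : ℂ → lp (fun _ : ℕ => ℂ) 2)
    (hc : ∀ (β : ℂ) (n : ℕ), c β n =
      Complex.exp (-((‖β‖ : ℂ)) ^ 2 / 2) * β ^ n / (Real.sqrt n.factorial : ℂ))
    (ι : Type*) (α : ι → ℂ) (hα : Function.Injective α) :
    LinearIndependent ℂ (fun i : ι => c (α i)) := by
  rw [linearIndependent_iff']
  intro s g hg i hi
  have hzero := eq_zero_of_forall_sum_mul_pow_eq_zero hα (s := s)
    (g := fun j => g j * Complex.exp (-((‖α j‖ : ℂ)) ^ 2 / 2)) (fun n => ?_) hi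
  · exact (mul_eq_zero.mp hzero).resolve_right (Complex.exp_ne_zero _)
  · have hsqrt : (Real.sqrt n.factorial : ℂ) ≠ 0 := by
      exact_mod_cast (Real.sqrt_pos.mpr (Nat.cast_pos.mpr n.factorial_pos)).ne'
    have hn : ∑ j ∈ s, g j * c (α j) n = 0 := by
      simpa only [map_sum, map_smul, map_zero, lp.evalₗ_apply, smul_eq_mul] using
        congrArg (lp.evalₗ (𝕜 := ℂ) (fun _ : ℕ => ℂ) 2 n) hg
    simp only [hc, mul_div_assoc', ← Finset.sum_div, div_eq_zero_iff, hsqrt, or_false] at hn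
    simpa only [mul_assoc] using hn
end

section
/- Let α > 0 be real and set x = exp(−α²/2), so 0 < x < 1. Then there exists an orthonormal family e₀, e₁, e₂ in ℓ²(ℕ, ℂ) such that c_0 = e₀, c_α = x e₀ + √(1 − x²) e₁, and c_{−α} = x e₀ − x²√(1 − x²) e₁ + √(1 − x² − x⁴ + x⁶) e₂, where c_0, c_α, c_{−α} are the coherent states with amplitudes 0, α, −α. (This is the inverse Gram-Schmidt orthonormalization of the qumode states appearing in the pure qutrit-qumode and mixed qubit-qumode hybrid entangled example states.) -/
open scoped ComplexConjugate InnerProductSpace in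
/-- The overlap of two coherent states. -/
theorem inner_coherent_state (c : ℂ → lp (fun _ : ℕ => ℂ) 2)
    (hc : ∀ (β : ℂ) (n : ℕ), c β n =
      Complex.exp (-((‖β‖ : ℂ)) ^ 2 / 2) * β ^ n / (Real.sqrt n.factorial : ℂ))
    (β γ : ℂ) :
    ⟪c β, c γ⟫_ℂ = Complex.exp (-(‖β‖ : ℂ) ^ 2 / 2 - (‖γ‖ : ℂ) ^ 2 / 2 + conj β * γ) := by
  have hsum : HasSum (fun n => ⟪c β n, c γ n⟫_ℂ)
      (Complex.exp (-(‖β‖ : ℂ) ^ 2 / 2) * Complex.exp (-(‖γ‖ : ℂ) ^ 2 / 2) *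
        Complex.exp (conj β * γ)) := by
    have h := NormedSpace.expSeries_div_hasSum_exp (conj β * γ)
    rw [← Complex.exp_eq_exp_ℂ] at h
    refine (h.mul_left
      (Complex.exp (-(‖β‖ : ℂ) ^ 2 / 2) * Complex.exp (-(‖γ‖ : ℂ) ^ 2 / 2))).congr_fun ?_
    intro n
    have hfact : ((Real.sqrt n.factorial : ℂ)) ^ 2 = n.factorial := by
      rw [← Complex.ofReal_pow, Real.sq_sqrt (Nat.cast_nonneg _), Complex.ofReal_natCast]
    have hexp : conj (Complex.exp (-(‖β‖ : ℂ) ^ 2 / 2)) = Complex.exp (-(‖β‖ : ℂ) ^ 2 / 2) := by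
      rw [← Complex.exp_conj]
      simp [Complex.conj_ofNat]
    rw [RCLike.inner_apply, hc, hc, map_div₀, map_mul, map_pow, Complex.conj_ofReal, hexp,
      ← hfact, mul_pow]
    ring
  rw [(lp.hasSum_inner (𝕜 := ℂ) (c β) (c γ)).unique hsum, ← Complex.exp_add, ← Complex.exp_add]
  congr 1
  ring

open scoped InnerProductSpace in
/-- Gram-Schmidt for three unit vectors with overlaps `x`, `x` and `x⁴`. -/
theorem exists_orthonormal_of_inner_eq {E : Type*} [NormedAddCommGroup E] [InnerProductSpace ℂ E]
    {u v w : E} {x : ℝ} (hx₀ : 0 < x) (hx₁ : x < 1)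
    (huu : ⟪u, u⟫_ℂ = 1) (hvv : ⟪v, v⟫_ℂ = 1) (hww : ⟪w, w⟫_ℂ = 1)
    (huv : ⟪u, v⟫_ℂ = x) (huw : ⟪u, w⟫_ℂ = x) (hvw : ⟪v, w⟫_ℂ = (x : ℂ) ^ 4) :
    ∃ e : Fin 3 → E, Orthonormal ℂ e ∧ u = e 0 ∧
      v = (x : ℂ) • e 0 + (Real.sqrt (1 - x ^ 2) : ℂ) • e 1 ∧
      w = (x : ℂ) • e 0 - ((x : ℂ) ^ 2 * (Real.sqrt (1 - x ^ 2) : ℂ)) • e 1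
        + (Real.sqrt (1 - x ^ 2 - x ^ 4 + x ^ 6) : ℂ) • e 2 := by
  have hvu : ⟪v, u⟫_ℂ = x := by rw [← inner_conj_symm, huv, Complex.conj_ofReal]
  have hwu : ⟪w, u⟫_ℂ = x := by rw [← inner_conj_symm, huw, Complex.conj_ofReal]
  have hwv : ⟪w, v⟫_ℂ = (x : ℂ) ^ 4 := by
    rw [← inner_conj_symm, hvw, map_pow, Complex.conj_ofReal]
  have hs : 0 < 1 - x ^ 2 := by nlinarith
  have ht : 0 < 1 - x ^ 2 - x ^ 4 + x ^ 6 := by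
    have : 1 - x ^ 2 - x ^ 4 + x ^ 6 = (1 - x ^ 2) ^ 2 * (1 + x ^ 2) := by ring
    rw [this]
    positivity
  have hs₂ : (Real.sqrt (1 - x ^ 2) : ℂ) ^ 2 = 1 - (x : ℂ) ^ 2 := by
    exact_mod_cast Real.sq_sqrt hs.le
  have ht₂ : (Real.sqrt (1 - x ^ 2 - x ^ 4 + x ^ 6) : ℂ) ^ 2 =
      1 - (x : ℂ) ^ 2 - (x : ℂ) ^ 4 + (x : ℂ) ^ 6 := by
    exact_mod_cast Real.sq_sqrt ht.le
  have hs₀ : (Real.sqrt (1 - x ^ 2) : ℂ) ≠ 0 := by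
    exact_mod_cast (Real.sqrt_pos.2 hs).ne'
  have ht₀ : (Real.sqrt (1 - x ^ 2 - x ^ 4 + x ^ 6) : ℂ) ≠ 0 := by
    exact_mod_cast (Real.sqrt_pos.2 ht).ne'
  generalize Real.sqrt (1 - x ^ 2) = s at *
  generalize Real.sqrt (1 - x ^ 2 - x ^ 4 + x ^ 6) = t at *
  refine ⟨![u, (s : ℂ)⁻¹ • (v - (x : ℂ) • u),
    (t : ℂ)⁻¹ • (w - (x : ℂ) • u + (x : ℂ) ^ 2 • (v - (x : ℂ) • u))], ?_, rfl, ?_, ?_⟩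
  · rw [orthonormal_iff_ite]
    intro i j
    fin_cases i <;> fin_cases j <;>
      simp [inner_add_left, inner_add_right, inner_sub_left, inner_sub_right, inner_smul_left,
        inner_smul_right, -inner_self_eq_norm_sq_to_K, -Complex.coe_smul, huu, hvv,
        hww, huv, huw, hvw, hvu, hwu, hwv] <;>
      (try field_simp) <;> grind
  · simp [smul_smul, hs₀]
  · simp [smul_smul, hs₀, ht₀]

/-- Inverse Gram-Schmidt orthonormalization of the coherent states `|vac⟩ = c_0`,
`c_α` and `c_{−α}` (real `α > 0`): with `x = exp(−α²/2)` there is an orthonormal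
family `e₀, e₁, e₂` in `ℓ²(ℕ, ℂ)` such that `c_0 = e₀`,
`c_α = x e₀ + √(1−x²) e₁` and
`c_{−α} = x e₀ − x²√(1−x²) e₁ + √(1−x²−x⁴+x⁶) e₂`. -/
theorem coherent_states_inverse_gram_schmidt
    (c : ℂ → lp (fun _ : ℕ => ℂ) 2)
    (hc : ∀ (β : ℂ) (n : ℕ), c β n =
      Complex.exp (-((‖β‖ : ℂ)) ^ 2 / 2) * β ^ n / (Real.sqrt n.factorial : ℂ))
    (α : ℝ) (hα : 0 < α) (x : ℝ) (hx : x = Real.exp (-α ^ 2 / 2)) :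
    (0 < x ∧ x < 1) ∧
    ∃ e : Fin 3 → lp (fun _ : ℕ => ℂ) 2, Orthonormal ℂ e ∧
      c 0 = e 0 ∧
      c (α : ℂ) = (x : ℂ) • e 0 + (Real.sqrt (1 - x ^ 2) : ℂ) • e 1 ∧
      c (-(α : ℂ)) = (x : ℂ) • e 0 - ((x : ℂ) ^ 2 * (Real.sqrt (1 - x ^ 2) : ℂ)) • e 1
        + (Real.sqrt (1 - x ^ 2 - x ^ 4 + x ^ 6) : ℂ) • e 2 := by
  have hx₀ : 0 < x := hx ▸ Real.exp_pos _
  have hx₁ : x < 1 := by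
    rw [hx, Real.exp_lt_one_iff]
    nlinarith
  have hnorm : ((‖(α : ℂ)‖ : ℝ) : ℂ) = α := by
    rw [Complex.norm_real, Real.norm_of_nonneg hα.le]
  have hxc : (x : ℂ) = Complex.exp (-(α : ℂ) ^ 2 / 2) := by
    rw [hx]
    push_cast
    rfl
  refine ⟨⟨hx₀, hx₁⟩, exists_orthonormal_of_inner_eq hx₀ hx₁ ?_ ?_ ?_ ?_ ?_ ?_⟩ <;>
    rw [inner_coherent_state c hc]
  · simp
  · rw [hnorm, Complex.conj_ofReal, Complex.exp_eq_one_iff]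
    exact ⟨0, by push_cast; ring⟩
  · rw [norm_neg, hnorm, map_neg, Complex.conj_ofReal, Complex.exp_eq_one_iff]
    exact ⟨0, by push_cast; ring⟩
  · rw [hnorm, hxc]
    congr 1
    simp
    ring
  · rw [norm_neg, hnorm, hxc]
    congr 1
    simp
    ring
  · rw [norm_neg, hnorm, hxc, Complex.conj_ofReal, ← Complex.exp_nat_mul]
    congr 1
    push_cast
    ring
end
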